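/- For m ≥ 2 let P = 𝔽₂^m ∖ {0} and let L ⊆ V^P be the Calderbank–Shor–Steane isotropic subspace obtained by placing the shortened Reed–Muller code R_*(m−2, m) in the z-coordinates and R_*(1, m) in the x-coordinates, with the standard section σ. Then the element g ∈ SO(3)^P whose component at every qubit is the rotation about the z-axis by angle 2π/2^{m−1} belongs to A(L,σ), and g has order 2^{m−1} in A(L,σ). -/

import Mathlib

/- Common framework: binary stabilizer codes, local unitary/SO(3) automorphism groups. -/

noncomputable section
open scoped Matrix Real ComplexConjugate
open scoped Classical

namespace Stab

/-- The one-qubit phase space `V = 𝔽₂ ⊕ 𝔽₂`, with first coordinate the `z`-component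
and second coordinate the `x`-component. -/
abbrev V : Type := ZMod 2 × ZMod 2

/-- The symplectic form on `V`. -/
def omegaV (u v : V) : ZMod 2 := u.1 * v.2 + u.2 * v.1

/-- The phase space `V^P` over a set of qubits `P`. -/
abbrev QV (P : Type) := P → V

variable {P : Type} [Fintype P] [DecidableEq P]

/-- The direct-sum symplectic form on `V^P`. -/
def omega (u v : QV P) : ZMod 2 := ∑ p, omegaV (u p) (v p)

/-- A subspace `L ⊆ V^P` is isotropic if `ω` vanishes identically on `L × L`. -/
def Isotropic (L : Submodule (ZMod 2) (QV P)) : Prop := ∀ u ∈ L, ∀ v ∈ L, omega u v = 0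

/-- Support of a vector of `V^P`. -/
def supp (v : QV P) : Set P := {p | v p ≠ 0}

/-- The basis vector `z_p`. -/
def zvec (p : P) : QV P := Pi.single p ((1 : ZMod 2), (0 : ZMod 2))

/-- The basis vector `x_p`. -/
def xvec (p : P) : QV P := Pi.single p ((0 : ZMod 2), (1 : ZMod 2))

/-- Restriction (coordinate projection) of a vector to a subset `S ⊆ P`. -/
def restrTo (S : Set P) (v : QV P) : QV P := fun p => if p ∈ S then v p else 0

/-- The coordinate subspace `V^S ⊆ V^P`. -/
def coordSub (S : Set P) : Submodule (ZMod 2) (QV P) where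
  carrier := {v | ∀ p ∉ S, v p = 0}
  add_mem' := by intro a b ha hb p hp; simp [Pi.add_apply, ha p hp, hb p hp]
  zero_mem' := by intro p _; rfl
  smul_mem' := by intro c a ha p hp; simp [Pi.smul_apply, ha p hp]

/-- `L_S := L ∩ V^S`. -/
def LS (L : Submodule (ZMod 2) (QV P)) (S : Set P) : Submodule (ZMod 2) (QV P) :=
  L ⊓ coordSub S

/-- `L` splits as a direct factor on `S`, i.e. `L = L_S × L_{P∖S}`. -/
def SplitsOn (L : Submodule (ZMod 2) (QV P)) (S : Set P) : Prop :=
  ∀ v ∈ L, restrTo S v ∈ L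

/-- `L` splits off a zero factor: on some nonempty `S ⊆ P` all vectors of `L` vanish. -/
def HasZeroFactor (L : Submodule (ZMod 2) (QV P)) : Prop :=
  ∃ S : Set P, S.Nonempty ∧ ∀ v ∈ L, ∀ p ∈ S, v p = 0

/-- The qubit `p` is trivial: `L` splits off a one-dimensional factor on `{p}`. -/
def TrivialQubit (L : Submodule (ZMod 2) (QV P)) (p : P) : Prop :=
  SplitsOn L {p} ∧ ∃ v ∈ L, v ≠ 0 ∧ supp v ⊆ {p}

/-- `L` splits off a trivial factor. -/
def HasTrivialFactor (L : Submodule (ZMod 2) (QV P)) : Prop :=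
  ∃ p : P, TrivialQubit L p

/-- `L` splits off a Bell Lagrangian: an indecomposable Lagrangian direct factor on a
two-element set of qubits (all of whose nonzero vectors have full support `{p, q}`). -/
def HasBellFactor (L : Submodule (ZMod 2) (QV P)) : Prop :=
  ∃ p q : P, p ≠ q ∧ SplitsOn L {p, q} ∧
    ∃ v ∈ L, ∃ w ∈ L, v ≠ w ∧ supp v = {p, q} ∧ supp w = {p, q} ∧ supp (v + w) = {p, q}

/-- The factor `L_S` (for `S` in a partition) is indecomposable. -/
def IndecompWithin (L : Submodule (ZMod 2) (QV P)) (S : Set P) : Prop :=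
  ∀ T ⊆ S, SplitsOn L T → T = ∅ ∨ T = S

/-! ### The Hilbert space, Pauli operators and stabilizer codes -/

/-- The state space `ℋ^{⊗P} = (ℂ²)^{⊗P}`, realised concretely as functions on
computational basis labels. -/
abbrev HP (P : Type) := (P → Fin 2) → ℂ

/-- Operators on `ℋ^{⊗P}` as matrices. -/
abbrev MatP (P : Type) := Matrix (P → Fin 2) (P → Fin 2) ℂ

/-- The tensor (local) operator `⊗_{p} g_p` on `ℋ^{⊗P}`. -/
def locOp (g : P → Matrix (Fin 2) (Fin 2) ℂ) : MatP P :=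
  Matrix.of fun u w => ∏ p, g p (u p) (w p)

def sigmaX : Matrix (Fin 2) (Fin 2) ℂ := !![0, 1; 1, 0]
def sigmaY : Matrix (Fin 2) (Fin 2) ℂ := !![0, -Complex.I; Complex.I, 0]
def sigmaZ : Matrix (Fin 2) (Fin 2) ℂ := !![1, 0; 0, -1]

/-- The one-qubit Pauli operator `Z^a X^b` attached to `(a, b) ∈ V`. -/
def pauliMat (v : V) : Matrix (Fin 2) (Fin 2) ℂ := sigmaZ ^ (v.1 : ZMod 2).val * sigmaX ^ (v.2 : ZMod 2).val

/-- The Pauli (Weyl) operator attached to `v ∈ V^P`. -/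
def Wop (v : QV P) : MatP P := locOp fun p => pauliMat (v p)

/-- A group-homomorphic section `σ` over `L` of the projection from the Pauli group
`Ṽ^P` onto `V^P`: each value `σ(v)` is a unitary scalar multiple of the Pauli operator
`W(v)`, and `σ` is multiplicative on `L`. -/
structure PauliSection (L : Submodule (ZMod 2) (QV P)) where
  toFun : QV P → MatP P
  scalar : ∀ v : QV P, ∃ c : ℂ, toFun v = c • Wop v
  unitary : ∀ v : QV P, toFun v ∈ Matrix.unitaryGroup (P → Fin 2) ℂ
  mul_of_mem : ∀ u ∈ L, ∀ v ∈ L, toFun (u + v) = toFun u * toFun v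
  map_zero : toFun 0 = 1

/-- The stabilizer code `C(L, σ)`: the common fixed-point space of the stabilizer
group `σ(L)`. -/
def code (L : Submodule (ZMod 2) (QV P)) (σ : PauliSection L) : Submodule ℂ (HP P) where
  carrier := {ψ | ∀ v ∈ L, σ.toFun v *ᵥ ψ = ψ}
  add_mem' := by intro a b ha hb v hv; rw [Matrix.mulVec_add, ha v hv, hb v hv]
  zero_mem' := by intro v hv; simp
  smul_mem' := by intro c a ha v hv; rw [Matrix.mulVec_smul, ha v hv]

/-- The standard section: `σ(v) = W(v)` on `L`. -/
def StandardOn (L : Submodule (ZMod 2) (QV P)) (σ : PauliSection L) : Prop :=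
  ∀ v ∈ L, σ.toFun v = Wop v

/-! ### `SO(3)`, rotations, and the automorphism group of a code -/

/-- `3×3` real matrices. -/
abbrev Rot : Type := Matrix (Fin 3) (Fin 3) ℝ

/-- `SO(3)` as a set of `3×3` real matrices. -/
def SO3 : Set Rot := {A | A * Aᵀ = 1 ∧ A.det = 1}

/-- The ordered Pauli basis (x, y, z) of traceless Hermitian `2×2` matrices. -/
def pauliBasis : Fin 3 → Matrix (Fin 2) (Fin 2) ℂ := ![sigmaX, sigmaY, sigmaZ]

/-- The image of a unitary `u ∈ U(2)` in `SO(3)` under the adjoint action on traceless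
Hermitian operators (the identification `U(2)/S¹ = SO(3)`):
`u σ_j u† = Σ_i (adjRot u)_{ij} σ_i`. -/
def adjRot (u : Matrix (Fin 2) (Fin 2) ℂ) : Rot :=
  Matrix.of fun i j =>
    (1 / 2 : ℝ) * ((pauliBasis i * u * pauliBasis j * u.conjTranspose).trace).re

/-- Rotation about the `x`-axis by angle `θ`. -/
def rotX (θ : ℝ) : Rot := !![1, 0, 0; 0, Real.cos θ, -Real.sin θ; 0, Real.sin θ, Real.cos θ]

/-- Rotation about the `y`-axis by angle `θ`. -/
def rotY (θ : ℝ) : Rot := !![Real.cos θ, 0, Real.sin θ; 0, 1, 0; -Real.sin θ, 0, Real.cos θ]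

/-- Rotation about the `z`-axis by angle `θ`. -/
def rotZ (θ : ℝ) : Rot := !![Real.cos θ, -Real.sin θ, 0; Real.sin θ, Real.cos θ, 0; 0, 0, 1]

/-- The circle group `C_x ⊆ SO(3)` of rotations about the `x`-axis. -/
def Cx : Set Rot := Set.range rotX

/-- The circle group `C_y ⊆ SO(3)` of rotations about the `y`-axis. -/
def Cy : Set Rot := Set.range rotY

/-- The circle group `C_z ⊆ SO(3)` of rotations about the `z`-axis. -/
def Cz : Set Rot := Set.range rotZ

/-- The octahedral group: the subgroup of `SO(3)` generated by the rotations by a right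
angle about the three coordinate axes. -/
def octahedral : Set Rot :=
  (Submonoid.closure {rotX (π / 2), rotY (π / 2), rotZ (π / 2)} : Submonoid Rot)

/-- The infinite dihedral group `D_x ⊆ SO(3)`. -/
def Dx : Set Rot := (Submonoid.closure (Cx ∪ {rotZ π}) : Submonoid Rot)

/-- The infinite dihedral group `D_y ⊆ SO(3)`. -/
def Dy : Set Rot := (Submonoid.closure (Cy ∪ {rotZ π}) : Submonoid Rot)

/-- The infinite dihedral group `D_z ⊆ SO(3)`. -/
def Dz : Set Rot := (Submonoid.closure (Cz ∪ {rotX π}) : Submonoid Rot)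

/-- The automorphism group `A(L, σ) ⊆ SO(3)^P` of the stabilizer code `C(L, σ)`:
all families of rotations admitting a local unitary lift mapping the code into itself. -/
def autSet (L : Submodule (ZMod 2) (QV P)) (σ : PauliSection L) : Set (P → Rot) :=
  {g | ∃ u : P → Matrix (Fin 2) (Fin 2) ℂ,
        (∀ p, u p ∈ Matrix.unitaryGroup (Fin 2) ℂ) ∧
        (∀ p, adjRot (u p) = g p) ∧
        ∀ ψ ∈ code L σ, locOp u *ᵥ ψ ∈ code L σ}

/-- The automorphism group `A(L, σ)_p` at the qubit `p`. -/
def autSetAt (L : Submodule (ZMod 2) (QV P)) (σ : PauliSection L) (p : P) : Set Rot :=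
  (fun g => g p) '' autSet L σ

/-- The normal subgroup `Z(L, σ)` of automorphisms acting by a scalar on the code. -/
def zSet (L : Submodule (ZMod 2) (QV P)) (σ : PauliSection L) : Set (P → Rot) :=
  {g | ∃ u : P → Matrix (Fin 2) (Fin 2) ℂ,
        (∀ p, u p ∈ Matrix.unitaryGroup (Fin 2) ℂ) ∧
        (∀ p, adjRot (u p) = g p) ∧
        ∃ c : ℂ, ∀ ψ ∈ code L σ, locOp u *ᵥ ψ = c • ψ}

/-! ### Restriction to subsets of qubits -/

/-- Restriction of a phase-space vector to the qubits of `S`. -/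
def resQV (S : Set P) (v : QV P) : QV ↥S := fun s => v s

/-- Restriction as a linear map. -/
def resLin (S : Set P) : QV P →ₗ[ZMod 2] QV ↥S where
  toFun := resQV S
  map_add' := by intros; rfl
  map_smul' := by intros; rfl

/-- `L_S`, regarded as a subspace of `V^S`. -/
def LSsub (L : Submodule (ZMod 2) (QV P)) (S : Set P) : Submodule (ZMod 2) (QV ↥S) :=
  Submodule.map (resLin S) (LS L S)

/-- The extension `M ⊗ 1` to `ℋ^{⊗P}` of an operator `M` on `ℋ^{⊗S}`. -/
def extendOp (S : Set P) (M : Matrix (↥S → Fin 2) (↥S → Fin 2) ℂ) : MatP P :=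
  Matrix.of fun u w =>
    if ∀ p ∉ S, u p = w p then M (fun s => u s) (fun s => w s) else 0

/-- `σ'` is the restriction `σ|_{L_S}` of the section `σ` to `L_S`. -/
def RestrictedSection (L : Submodule (ZMod 2) (QV P)) (σ : PauliSection L) (S : Set P)
    (σ' : PauliSection (LSsub L S)) : Prop :=
  ∀ v ∈ LS L S, extendOp S (σ'.toFun (resQV S v)) = σ.toFun v

/-! ### Contiguity, protected and gauge qubits, and normal forms -/

/-- Two qubits are contiguous if they are equal or `L` contains a vector supported
exactly on the pair. -/
def Contig (L : Submodule (ZMod 2) (QV P)) (p q : P) : Prop :=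
  p = q ∨ ∃ v ∈ L, supp v = ({p, q} : Set P)

/-- The contiguity class of a qubit. -/
def contigClass (L : Submodule (ZMod 2) (QV P)) (p : P) : Set P := {q | Contig L p q}

/-- The qubit `p` is protected: the projection `L → V^{{p}}` is surjective. -/
def IsProtected (L : Submodule (ZMod 2) (QV P)) (p : P) : Prop :=
  ∀ w : V, ∃ v ∈ L, v p = w

/-- The qubit `p` is of gauge type: the projection `L → V^{{p}}` has a line as image. -/
def IsGauge (L : Submodule (ZMod 2) (QV P)) (p : P) : Prop :=
  ¬ IsProtected L p ∧ ∃ v ∈ L, v p ≠ 0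

/-- The subspace `⟨z_a + z_b : a ≠ b ∈ S⟩`. -/
def zspan (S : Set P) : Submodule (ZMod 2) (QV P) :=
  Submodule.span (ZMod 2) {w | ∃ a ∈ S, ∃ b ∈ S, a ≠ b ∧ w = zvec a + zvec b}

/-- The vector `Σ_{s ∈ S} x_s`. -/
def xsumOn (S : Set P) : QV P := S.indicator fun _ => ((0 : ZMod 2), (1 : ZMod 2))

/-- Normal form of `L` (conclusion of the normalisation lemma): every contiguity class `S`
carries either `⟨z_a + z_b⟩` or `⟨z_a + z_b⟩ + ⟨Σ_{s∈S} x_s⟩`. -/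
def NormalForm (L : Submodule (ZMod 2) (QV P)) : Prop :=
  ∀ p : P,
    LS L (contigClass L p) = zspan (contigClass L p) ∨
    LS L (contigClass L p) =
      zspan (contigClass L p) ⊔ Submodule.span (ZMod 2) {xsumOn (contigClass L p)}

/-- The pair `(L, σ)` is normalised. -/
def Normalised (L : Submodule (ZMod 2) (QV P)) (σ : PauliSection L) : Prop :=
  NormalForm L ∧
  (∀ p : P, IsGauge L p → contigClass L p = {p} → ∀ v ∈ L, (v p).2 = 0) ∧
  (∀ p : P, IsProtected L p → contigClass L p = {p} →
    connectedComponentIn (autSetAt L σ p) 1 ⊆ Cz) ∧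
  (∀ p : P, IsProtected L p → contigClass L p ≠ {p} →
    LS L (contigClass L p) = zspan (contigClass L p) →
    ∃ v ∈ L, ∀ s ∈ contigClass L p, v s = ((0 : ZMod 2), (1 : ZMod 2))) ∧
  (∀ p q : P, p ≠ q → Contig L p q →
    σ.toFun (zvec p + zvec q) = Wop (zvec p + zvec q))

/-- A local symplectic family of automorphisms of `V`. -/
def IsLocalSymp (f : P → (V ≃ₗ[ZMod 2] V)) : Prop :=
  ∀ (p : P) (u v : V), omegaV (f p u) (f p v) = omegaV u v

/-- The image of `L` under a local (symplectic) transformation. -/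
def mapL (L : Submodule (ZMod 2) (QV P)) (f : P → (V ≃ₗ[ZMod 2] V)) :
    Submodule (ZMod 2) (QV P) :=
  Submodule.map (LinearEquiv.piCongrRight f : QV P ≃ₗ[ZMod 2] QV P).toLinearMap L

/-! ### Abstract group structures carried by subsets of a monoid -/

/-- The set `s` carries the structure of a solvable group. -/
structure SolvableGroupStructure (M : Type) [Monoid M] (s : Set M) where
  G : Type
  [grp : Group G]
  solv : IsSolvable G
  f : G → M
  inj : Function.Injective f
  map_mul : ∀ a b : G, f (a * b) = f a * f b
  range_eq : Set.range f = s

/-- The quotient of the group (carried by) `A` by the normal subgroup (carried by) `Z`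
is a compact solvable topological (Lie) group. -/
structure CompactSolvableQuotientStructure (M : Type) [Monoid M] [TopologicalSpace M]
    (A Z : Set M) where
  G : Type
  [grp : Group G]
  [top : TopologicalSpace G]
  [tgrp : IsTopologicalGroup G]
  cpt : CompactSpace G
  solv : IsSolvable G
  φ : M → G
  cont : ContinuousOn φ A
  map_mul' : ∀ a ∈ A, ∀ b ∈ A, φ (a * b) = φ a * φ b
  surj : ∀ y : G, ∃ a ∈ A, φ a = y
  ker : ∀ a ∈ A, (φ a = 1 ↔ a ∈ Z)

/-! ### Logical qubits and transversally realisable gates -/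

/-- The standard hermitian inner product on a finite-dimensional function space. -/
def innerF {ι : Type} [Fintype ι] (ψ φ : ι → ℂ) : ℂ := ∑ i, (starRingEnd ℂ) (ψ i) * φ i

/-- `e` is a unitary identification of the code space with a space of logical qubits. -/
def IsUnitaryEquiv (L : Submodule (ZMod 2) (QV P)) (σ : PauliSection L) {d : ℕ}
    (e : ↥(code L σ) ≃ₗ[ℂ] HP (Fin d)) : Prop :=
  ∀ ψ φ : ↥(code L σ),
    innerF (e ψ) (e φ) = innerF (ψ : HP P) (φ : HP P)

/-- The operator acting as `w` on the logical qubit `k` and trivially elsewhere. -/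
def oneQubitOp (d : ℕ) (k : Fin d) (w : Matrix (Fin 2) (Fin 2) ℂ) : MatP (Fin d) :=
  locOp fun j => if j = k then w else 1

/-- The set of rotations in `SO(3)` induced, via the identification `e`, on a fixed
logical qubit `k` by (exactly realised) transversal gates, i.e. by elements of `A(L, σ)`. -/
def logicalSet (L : Submodule (ZMod 2) (QV P)) (σ : PauliSection L) {d : ℕ}
    (e : ↥(code L σ) ≃ₗ[ℂ] HP (Fin d)) (k : Fin d) : Set Rot :=
  {A | ∃ w ∈ Matrix.unitaryGroup (Fin 2) ℂ, adjRot w = A ∧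
        ∃ u : P → Matrix (Fin 2) (Fin 2) ℂ,
          (∀ p, u p ∈ Matrix.unitaryGroup (Fin 2) ℂ) ∧
          ∀ φ : HP (Fin d),
            locOp u *ᵥ ((e.symm φ : HP P)) = ((e.symm (oneQubitOp d k w *ᵥ φ) : HP P))}

/-! ### Reed–Muller codes -/

/-- The qubit set `P = 𝔽₂^m ∖ {0}`. -/
abbrev RMQubits (m : ℕ) := {s : Fin m → ZMod 2 // s ≠ 0}

/-- Polynomial functions on `𝔽₂^m` of degree at most `r` with zero constant term. -/
def RMspan (r m : ℕ) : Submodule (ZMod 2) ((Fin m → ZMod 2) → ZMod 2) :=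
  Submodule.span (ZMod 2)
    {f | ∃ I : Finset (Fin m), I.Nonempty ∧ I.card ≤ r ∧ f = fun s => ∏ i ∈ I, s i}

/-- The shortened Reed–Muller code `R_*(r, m) ⊆ 𝔽₂^P`. -/
def RMstar (r m : ℕ) : Submodule (ZMod 2) (RMQubits m → ZMod 2) :=
  Submodule.map (LinearMap.funLeft (ZMod 2) (ZMod 2) Subtype.val) (RMspan r m)

/-- The `z`-part of a phase-space vector. -/
def zPart {P : Type} : QV P →ₗ[ZMod 2] (P → ZMod 2) where
  toFun v := fun p => (v p).1
  map_add' := by intros; rfl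
  map_smul' := by intros; rfl

/-- The `x`-part of a phase-space vector. -/
def xPart {P : Type} : QV P →ₗ[ZMod 2] (P → ZMod 2) where
  toFun v := fun p => (v p).2
  map_add' := by intros; rfl
  map_smul' := by intros; rfl

/-- The Calderbank–Shor–Steane isotropic subspace built from the shortened Reed–Muller
codes `R_*(m−2, m)` (in the `z`-coordinates) and `R_*(1, m)` (in the `x`-coordinates). -/
def cssL (m : ℕ) : Submodule (ZMod 2) (QV (RMQubits m)) :=
  Submodule.comap zPart (RMstar (m - 2) m) ⊓ Submodule.comap xPart (RMstar 1 m)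

/-- The stabilizer state `|0⟩_S ⊗ |0⟩_T + |0⟩_S ⊗ |1⟩_T + |1⟩_S ⊗ |0⟩_T − |1⟩_S ⊗ |1⟩_T`
(with `T = Sᶜ`), written in the computational basis. -/
def bellLike (S : Set P) (p q : P) : HP P := fun u =>
  if (∀ a ∈ S, u a = u p) ∧ (∀ a ∈ Sᶜ, u a = u q) then
    ((-1 : ℂ)) ^ ((u p : Fin 2).val * (u q : Fin 2).val) else 0


/-- A diagonal-times-permutation local operator acts on a state by relabelling and a phase. -/
lemma locOp_mulVec_of_monomial (g : P → Matrix (Fin 2) (Fin 2) ℂ) (τ : P → Fin 2 → Fin 2)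
    (a : P → Fin 2 → ℂ) (hg : ∀ p i j, g p i j = if j = τ p i then a p i else 0)
    (ψ : HP P) (u : P → Fin 2) :
    (locOp g *ᵥ ψ) u = (∏ p, a p (u p)) * ψ (fun p => τ p (u p)) := by
  have key : ∀ w : P → Fin 2, locOp g u w =
      if w = (fun p => τ p (u p)) then ∏ p, a p (u p) else 0 := by
    intro w
    simp only [locOp, Matrix.of_apply, hg]
    split_ifs with h
    · subst h
      simp
    · obtain ⟨p, hp⟩ := Function.ne_iff.mp h
      exact Finset.prod_eq_zero (Finset.mem_univ p) (if_neg hp)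
  simp only [Matrix.mulVec, dotProduct]
  rw [Finset.sum_eq_single (fun p => τ p (u p))]
  · rw [key, if_pos rfl]
  · intro w _ hw
    rw [key, if_neg hw, zero_mul]
  · intro h
    exact absurd (Finset.mem_univ _) h

lemma zmod_two_eq_zero_or_one : ∀ b : ZMod 2, b = 0 ∨ b = 1 := by decide

lemma neg_one_pow_val (b : ZMod 2) : (-1 : ℂ) ^ b.val = if b = 0 then 1 else -1 := by
  rcases zmod_two_eq_zero_or_one b with rfl | rfl <;> simp [ZMod.val_one]

lemma pauliMat_apply (v : V) (i j : ZMod 2) :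
    pauliMat v i j = if j = i + v.2 then (-1 : ℂ) ^ (v.1 * i).val else 0 := by
  obtain ⟨a, b⟩ := v
  have h01 : ¬(0 : ZMod 2) = 1 := by decide
  have h10 : ¬(1 : ZMod 2) = 0 := by decide
  rw [neg_one_pow_val]
  fin_cases a <;> fin_cases b <;> fin_cases i <;> fin_cases j <;>
    first
    | rw [if_neg (by first | exact h01 | exact h10)]
      simp [pauliMat, sigmaX, sigmaZ, ZMod.val]
    | rw [if_pos (by rfl), if_pos (by rfl)]
      simp [pauliMat, sigmaX, sigmaZ, ZMod.val]
    | rw [if_pos (by rfl), if_neg (by first | exact h01 | exact h10)]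
      simp [pauliMat, sigmaX, sigmaZ, ZMod.val]

/-- The action of a Pauli operator in the computational basis. -/
lemma Wop_mulVec (v : QV P) (ψ : HP P) (u : P → ZMod 2) :
    (Wop v *ᵥ ψ) u = (∏ p, (-1 : ℂ) ^ ((v p).1 * u p).val) * ψ (u + xPart v) :=
  locOp_mulVec_of_monomial _ (fun p (i : ZMod 2) => (i + (v p).2 : ZMod 2))
    (fun p (i : ZMod 2) => (-1 : ℂ) ^ ((v p).1 * i).val)
    (fun p i j => pauliMat_apply (v p) i j) ψ u

lemma neg_one_pow_val_add (a b : ZMod 2) :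
    (-1 : ℂ) ^ (a + b).val = (-1) ^ a.val * (-1) ^ b.val := by
  rcases zmod_two_eq_zero_or_one a with rfl | rfl <;>
    rcases zmod_two_eq_zero_or_one b with rfl | rfl <;>
    simp [ZMod.val_one, CharTwo.add_self_eq_zero]

lemma prod_neg_one_pow_val {ι : Type*} (s : Finset ι) (f : ι → ZMod 2) :
    ∏ i ∈ s, (-1 : ℂ) ^ (f i).val = (-1) ^ (∑ i ∈ s, f i).val := by
  induction s using Finset.induction_on with
  | empty => simp
  | insert i s hi ih => rw [Finset.prod_insert hi, Finset.sum_insert hi, neg_one_pow_val_add, ih]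

/-- The phase gate `diag(1, e^{iθ})`. -/
def phaseMat (θ : ℝ) : Matrix (Fin 2) (Fin 2) ℂ := !![1, 0; 0, Complex.exp (θ * Complex.I)]

lemma exp_mul_conj_exp (θ : ℝ) :
    Complex.exp (θ * Complex.I) * conj (Complex.exp (θ * Complex.I)) = 1 := by
  rw [← Complex.exp_conj, ← Complex.exp_add]
  simp

lemma phaseMat_mem_unitaryGroup (θ : ℝ) : phaseMat θ ∈ Matrix.unitaryGroup (Fin 2) ℂ := by
  rw [Matrix.mem_unitaryGroup_iff]
  have h := exp_mul_conj_exp θ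
  ext i j
  fin_cases i <;> fin_cases j <;>
    simp [phaseMat, Matrix.mul_apply, Matrix.star_apply, Fin.sum_univ_two]
  simpa using h

lemma adjRot_phaseMat (θ : ℝ) : adjRot (phaseMat θ) = rotZ θ := by
  have h := exp_mul_conj_exp θ
  ext i j
  fin_cases i <;> fin_cases j <;>
    simp [adjRot, rotZ, phaseMat, pauliBasis, sigmaX, sigmaY, sigmaZ, Matrix.trace,
      Matrix.mul_apply, Fin.sum_univ_two, Matrix.conjTranspose_apply,
      Complex.exp_ofReal_mul_I_re, Complex.exp_ofReal_mul_I_im] <;>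
    nlinarith [Real.sin_sq_add_cos_sq θ]

lemma phaseMat_apply (θ : ℝ) (i j : ZMod 2) :
    phaseMat θ i j = if j = i then Complex.exp (θ * Complex.I) ^ i.val else 0 := by
  have h01 : ¬(0 : ZMod 2) = 1 := by decide
  have h10 : ¬(1 : ZMod 2) = 0 := by decide
  fin_cases i <;> fin_cases j <;>
    first
    | rw [if_neg (by first | exact h01 | exact h10)]
      simp [phaseMat]
    | rw [if_pos (by rfl)]
      simp [phaseMat, ZMod.val]

lemma locOp_phaseMat_mulVec (θ : ℝ) (ψ : HP P) (u : P → ZMod 2) :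
    (locOp (fun _ => phaseMat θ) *ᵥ ψ) u =
      Complex.exp (θ * Complex.I) ^ (∑ p, (u p).val) * ψ u := by
  rw [← Finset.prod_pow_eq_pow_sum]
  exact locOp_mulVec_of_monomial _ (fun _ i => i)
    (fun _ (i : ZMod 2) => Complex.exp (θ * Complex.I) ^ i.val)
    (fun _ i j => phaseMat_apply θ i j) ψ u

/-! ### Rotations about the `z`-axis -/

lemma rotZ_zero : rotZ 0 = 1 := by
  ext i j
  fin_cases i <;> fin_cases j <;> simp [rotZ]

lemma rotZ_add (a b : ℝ) : rotZ (a + b) = rotZ a * rotZ b := by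
  ext i j
  fin_cases i <;> fin_cases j <;>
    simp [rotZ, Matrix.mul_apply, Fin.sum_univ_three, Real.cos_add, Real.sin_add] <;> ring

lemma rotZ_pow (θ : ℝ) (n : ℕ) : rotZ θ ^ n = rotZ (n * θ) := by
  induction n with
  | zero => simp [rotZ_zero]
  | succ n ih => rw [pow_succ, ih, ← rotZ_add]; congr 1; push_cast; ring

lemma orderOf_rotZ {N : ℕ} (hN : 0 < N) : orderOf (rotZ (2 * π / N)) = N := by
  have hN' : (N : ℝ) ≠ 0 := by positivity
  rw [orderOf_eq_iff hN]
  refine ⟨?_, fun k hk hk0 h => ?_⟩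
  · rw [rotZ_pow, mul_div_cancel₀ _ hN']
    ext i j
    fin_cases i <;> fin_cases j <;> simp [rotZ]
  · rw [rotZ_pow] at h
    have hc : Real.cos (k * (2 * π / N)) = 1 := by
      have := congrFun (congrFun h 0) 0
      simpa [rotZ] using this
    obtain ⟨n, hn⟩ := (Real.cos_eq_one_iff _).mp hc
    have h1 : (n : ℝ) * N = k := by
      have hpi := Real.pi_ne_zero
      field_simp at hn
      linarith
    have h2 : n * (N : ℤ) = k := by exact_mod_cast h1
    have h3 : (N : ℤ) ∣ k := ⟨n, by rw [← h2, mul_comm]⟩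
    exact absurd (Nat.le_of_dvd hk0 (Int.natCast_dvd_natCast.mp h3)) (by omega)

/-! ### Affine functions on `𝔽₂^m` -/

/-- `g` is affine: its difference in each coordinate direction is constant. -/
def IsAffineFn {m : ℕ} (g : (Fin m → ZMod 2) → ZMod 2) : Prop :=
  ∀ i, ∃ c, ∀ a, g (a + Pi.single i 1) = g a + c

lemma eq_apply_zero_of_periodic {m : ℕ} (g : (Fin m → ZMod 2) → ZMod 2)
    (hg : ∀ i a, g (a + Pi.single i 1) = g a) (a : Fin m → ZMod 2) : g a = g 0 := by
  suffices h : ∀ b, g (b + a) = g b by simpa using h 0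
  rw [← Finset.univ_sum_single a]
  refine Finset.sum_induction _ (fun t => ∀ b, g (b + t) = g b) ?_ (by simp) ?_
  · intro s t hs ht b
    rw [← add_assoc, ht, hs]
  · intro i _ b
    obtain h | h := zmod_two_eq_zero_or_one (a i)
    · simp [h]
    · rw [h, hg]

lemma IsAffineFn.add {m : ℕ} {f g : (Fin m → ZMod 2) → ZMod 2} (hf : IsAffineFn f)
    (hg : IsAffineFn g) : IsAffineFn (f + g) := by
  intro i
  obtain ⟨c, hc⟩ := hf i
  obtain ⟨d, hd⟩ := hg i
  refine ⟨c + d, fun a => ?_⟩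
  simp only [Pi.add_apply, hc, hd]
  ring

lemma IsAffineFn.smul {m : ℕ} {f : (Fin m → ZMod 2) → ZMod 2} (r : ZMod 2)
    (hf : IsAffineFn f) : IsAffineFn (r • f) := by
  intro i
  obtain ⟨c, hc⟩ := hf i
  refine ⟨r * c, fun a => ?_⟩
  simp only [Pi.smul_apply, hc, smul_eq_mul]
  ring

/-- The Hamming weight of an affine function on `𝔽₂^m` is divisible by `2^(m-1)`. -/
lemma IsAffineFn.dvd_weight {m : ℕ} {g : (Fin m → ZMod 2) → ZMod 2} (hg : IsAffineFn g)
    (hm : 1 ≤ m) : 2 ^ (m - 1) ∣ ∑ s, (g s).val := by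
  have hcard : Fintype.card (Fin m → ZMod 2) = 2 * 2 ^ (m - 1) := by
    rw [Fintype.card_fun, ZMod.card, Fintype.card_fin, ← pow_succ']
    congr 1
    omega
  by_cases h : ∀ i a, g (a + Pi.single i 1) = g a
  · have : ∀ s, (g s).val = (g 0).val := fun s => by rw [eq_apply_zero_of_periodic g h s]
    simp only [this, Finset.sum_const, Finset.card_univ, hcard, smul_eq_mul]
    exact ⟨2 * (g 0).val, by ring⟩
  · push Not at h
    obtain ⟨i, a, ha⟩ := h
    obtain ⟨c, hc⟩ := hg i
    have hc1 : c = 1 := by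
      refine (zmod_two_eq_zero_or_one c).resolve_left fun h0 => ha ?_
      rw [hc, h0, add_zero]
    subst hc1
    have hflip : ∑ s : Fin m → ZMod 2, (g (s + Pi.single i 1)).val = ∑ s, (g s).val :=
      Equiv.sum_comp (Equiv.addRight (Pi.single i 1)) fun s => (g s).val
    have hpair : ∀ b : ZMod 2, b.val + (b + 1).val = 1 := by decide
    have htwo : ∑ s, (g s).val + ∑ s : Fin m → ZMod 2, (g (s + Pi.single i 1)).val =
        2 * 2 ^ (m - 1) := by
      rw [← Finset.sum_add_distrib, ← hcard, Fintype.card_eq_sum_ones]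
      exact Finset.sum_congr rfl fun s _ => by rw [hc, hpair]
    exact ⟨1, by omega⟩

/-- Elements of the linear Reed–Muller span are affine and vanish at the origin. -/
lemma isAffineFn_of_mem_RMspan_one {m : ℕ} {f : (Fin m → ZMod 2) → ZMod 2}
    (hf : f ∈ RMspan 1 m) : IsAffineFn f ∧ f 0 = 0 := by
  induction hf using Submodule.span_induction with
  | mem f h =>
    obtain ⟨I, hI, hcard, rfl⟩ := h
    obtain ⟨k, rfl⟩ := Finset.card_eq_one.mp (le_antisymm hcard hI.card_pos)
    refine ⟨fun i => ⟨(Pi.single i 1 : Fin m → ZMod 2) k, fun a => by simp⟩, by simp⟩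
  | zero => exact ⟨fun i => ⟨0, fun a => by simp⟩, rfl⟩
  | add f g _ _ hf hg => exact ⟨hf.1.add hg.1, by simp [hf.2, hg.2]⟩
  | smul r f _ hf => exact ⟨hf.1.smul r, by simp [hf.2]⟩

/-- The indicator function of a coordinate plane in `𝔽₂^m` picks out its four points. -/
lemma sum_mul_plane_indicator {m : ℕ} (f : (Fin m → ZMod 2) → ZMod 2) {i j : Fin m}
    (hij : i ≠ j) (a : Fin m → ZMod 2) :
    ∑ s, f s * ∏ k ∈ {i, j}ᶜ, (s k + (a k + 1)) =
      f a + f (a + Pi.single i 1) + (f (a + Pi.single j 1) +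
        f (a + Pi.single j 1 + Pi.single i 1)) := by
  have hne : ∀ b : ZMod 2, b + 1 ≠ b := by decide
  have hcases : ∀ b c : ZMod 2, b = c ∨ b = c + 1 := by decide
  have hone : ∀ b : ZMod 2, b + (b + 1) = 1 ∧ b + 1 + (b + 1) = 0 := by decide
  set S : Finset (Fin m → ZMod 2) := {a, a + Pi.single i 1, a + Pi.single j 1,
    a + Pi.single j 1 + Pi.single i 1} with hS
  have hval : ∀ s : Fin m → ZMod 2, s ∈ S ↔ ∀ k, k ≠ i → k ≠ j → s k = a k := by
    intro s
    simp only [hS, Finset.mem_insert, Finset.mem_singleton]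
    constructor
    · rintro (rfl | rfl | rfl | rfl) k hki hkj <;> simp [hki, hkj]
    · intro h
      have hext : ∀ t : Fin m → ZMod 2, (∀ k, k ≠ i → k ≠ j → t k = a k) → s i = t i →
          s j = t j → s = t := by
        intro t ht hi hj
        ext1 k
        by_cases hki : k = i
        · rw [hki, hi]
        by_cases hkj : k = j
        · rw [hkj, hj]
        rw [h k hki hkj, ht k hki hkj]
      rcases hcases (s i) (a i) with hi | hi <;> rcases hcases (s j) (a j) with hj | hj
      · exact Or.inl (hext _ (fun _ _ _ => rfl) hi hj)
      · exact Or.inr (Or.inr (Or.inl (hext _ (fun k _ h2 => by simp [h2])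
          (by simp [hi, hij]) (by simp [hj]))))
      · exact Or.inr (Or.inl (hext _ (fun k h1 _ => by simp [h1])
          (by simp [hi]) (by simp [hj, hij.symm])))
      · exact Or.inr (Or.inr (Or.inr (hext _ (fun k h1 h2 => by simp [h1, h2])
          (by simp [hi, hij]) (by simp [hj, hij.symm]))))
  have hprod : ∀ s : Fin m → ZMod 2, f s * ∏ k ∈ {i, j}ᶜ, (s k + (a k + 1)) =
      if s ∈ S then f s else 0 := by
    intro s
    split_ifs with h
    · rw [Finset.prod_eq_one, mul_one]
      intro k hk
      simp only [Finset.mem_compl, Finset.mem_insert, Finset.mem_singleton, not_or] at hk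
      rw [(hval s).mp h k hk.1 hk.2, (hone _).1]
    · rw [hval] at h
      push Not at h
      obtain ⟨k, hki, hkj, hk⟩ := h
      rw [Finset.prod_eq_zero (i := k) (by simp [hki, hkj]), mul_zero]
      rw [(hcases (s k) (a k)).resolve_left hk, (hone _).2]
  have hd : ∀ {s t : Fin m → ZMod 2} (k : Fin m), s k ≠ t k → s ≠ t :=
    fun k h e => h (congrFun e k)
  rw [Finset.sum_congr rfl fun s _ => hprod s, Finset.sum_ite_mem, Finset.univ_inter, hS,
    Finset.sum_insert, Finset.sum_insert, Finset.sum_insert, Finset.sum_singleton]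
  · ring
  · simp
  · simp only [Finset.mem_insert, Finset.mem_singleton, not_or]
    exact ⟨hd i (by simp [hij, hne]), hd j (by simp [hij.symm])⟩
  · simp only [Finset.mem_insert, Finset.mem_singleton, not_or]
    exact ⟨hd i (by simp), hd j (by simp), hd i (by simp [hij])⟩

/-- A function orthogonal to all monomials of degree at most `m - 2` is affine. -/
lemma isAffineFn_of_orthogonal {m : ℕ} (f : (Fin m → ZMod 2) → ZMod 2)
    (hf : ∀ I : Finset (Fin m), I.card ≤ m - 2 → ∑ s, f s * ∏ k ∈ I, s k = 0) :
    IsAffineFn f := by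
  have hplane : ∀ i j : Fin m, i ≠ j → ∀ a, f a + f (a + Pi.single i 1) +
      (f (a + Pi.single j 1) + f (a + Pi.single j 1 + Pi.single i 1)) = 0 := by
    intro i j hij a
    rw [← sum_mul_plane_indicator f hij a]
    simp only [Finset.prod_add _ (fun k => a k + 1), Finset.mul_sum]
    rw [Finset.sum_comm]
    refine Finset.sum_eq_zero fun t ht => ?_
    have hcard : t.card ≤ m - 2 := by
      refine (Finset.card_le_card (Finset.mem_powerset.mp ht)).trans ?_
      rw [Finset.card_compl, Fintype.card_fin, Finset.card_pair hij]
    simp only [← mul_assoc]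
    rw [← Finset.sum_mul, hf t hcard, zero_mul]
  have hadd : ∀ b c : ZMod 2, b + c = 0 → c = b := by decide
  have hself : ∀ b c : ZMod 2, c = b + (b + c) := by decide
  intro i
  refine ⟨f 0 + f (0 + Pi.single i 1), fun a => ?_⟩
  have hper := eq_apply_zero_of_periodic (fun a => f a + f (a + Pi.single i 1)) ?_ a
  · rw [← hper]
    exact hself _ _
  · intro j a
    by_cases hij : i = j
    · subst hij
      have h2 : (Pi.single i 1 : Fin m → ZMod 2) + Pi.single i 1 = 0 := by
        rw [← Pi.single_add]
        exact Pi.single_eq_zero_iff.mpr (by decide)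
      simp only [add_assoc, h2, add_zero]
      exact add_comm _ _
    · exact hadd _ _ (hplane i j hij a)

/-! ### Extension of functions on the punctured space by a value at the origin -/

/-- The extension of `u : 𝔽₂^m ∖ {0} → 𝔽₂` by the value `c` at the origin. -/
def extendAtZero {m : ℕ} (c : ZMod 2) (u : RMQubits m → ZMod 2) (s : Fin m → ZMod 2) : ZMod 2 :=
  if h : s ≠ 0 then u ⟨s, h⟩ else c

lemma extendAtZero_zero {m : ℕ} (c : ZMod 2) (u : RMQubits m → ZMod 2) :
    extendAtZero c u 0 = c := by simp [extendAtZero]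

lemma extendAtZero_coe {m : ℕ} (c : ZMod 2) (u : RMQubits m → ZMod 2) (p : RMQubits m) :
    extendAtZero c u p = u p := by simp [extendAtZero, p.2]

lemma sum_eq_apply_zero_add {m : ℕ} {M : Type*} [AddCommMonoid M]
    (F : (Fin m → ZMod 2) → M) : ∑ s, F s = F 0 + ∑ p : RMQubits m, F p := by
  rw [← Finset.add_sum_erase _ _ (Finset.mem_univ 0)]
  congr 1
  exact Finset.sum_subtype _ (by simp) F

/-- A word orthogonal to `R_*(m-2,m)`, extended by its parity at the origin, is affine. -/
lemma isAffineFn_extendAtZero {m : ℕ} (u : RMQubits m → ZMod 2)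
    (hu : ∀ z ∈ RMstar (m - 2) m, ∑ p, z p * u p = 0) :
    IsAffineFn (extendAtZero (∑ p, u p) u) := by
  apply isAffineFn_of_orthogonal
  intro I hI
  rw [sum_eq_apply_zero_add]
  simp only [extendAtZero_zero, extendAtZero_coe]
  have hself : ∀ b : ZMod 2, b + b = 0 := by decide
  rcases I.eq_empty_or_nonempty with rfl | hne
  · simp [hself]
  · obtain ⟨k, hk⟩ := hne
    rw [Finset.prod_eq_zero hk (by rfl), mul_zero, zero_add,
      ← hu _ (Submodule.mem_map_of_mem (Submodule.subset_span ⟨I, ⟨k, hk⟩, hI, rfl⟩))]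
    exact Finset.sum_congr rfl fun p _ => mul_comm _ _

/-- The weights of the words of a coset of `R_*(1,m)` in the dual of `R_*(m-2,m)` agree
modulo `2^(m-1)`. -/
lemma pow_weight_add_eq {m : ℕ} (hm : 1 ≤ m) {ζ : ℂ} (hζ : ζ ^ 2 ^ (m - 1) = 1)
    (u x : RMQubits m → ZMod 2) (hu : ∀ z ∈ RMstar (m - 2) m, ∑ p, z p * u p = 0)
    (hx : x ∈ RMstar 1 m) :
    ζ ^ (∑ p, ((u + x) p).val) = ζ ^ (∑ p, (u p).val) := by
  obtain ⟨f, hf, rfl⟩ := hx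
  obtain ⟨hf, hf0⟩ := isAffineFn_of_mem_RMspan_one hf
  have hg := isAffineFn_extendAtZero u hu
  set c := ∑ p, u p
  have h1 := hg.dvd_weight hm
  have h2 := (hg.add hf).dvd_weight hm
  rw [sum_eq_apply_zero_add] at h1 h2
  simp only [Pi.add_apply, extendAtZero_zero, extendAtZero_coe, hf0, add_zero] at h1 h2
  have hone : ∀ n, 2 ^ (m - 1) ∣ n → ζ ^ n = 1 := by
    rintro n ⟨k, rfl⟩
    rw [pow_mul, hζ, one_pow]
  have hζ0 : ζ ^ c.val ≠ 0 := by
    refine pow_ne_zero _ fun h => ?_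
    rw [h, zero_pow (by positivity)] at hζ
    exact zero_ne_one hζ
  apply mul_left_cancel₀ hζ0
  rw [← pow_add, ← pow_add, hone _ h1]
  exact hone _ h2

/-- Computational basis states occurring in a codeword are orthogonal to `R_*(m-2,m)`. -/
lemma sum_mul_eq_zero_of_apply_ne_zero {m : ℕ} {σ : PauliSection (cssL m)}
    (hσ : StandardOn (cssL m) σ) {ψ : HP (RMQubits m)} (hψ : ψ ∈ code (cssL m) σ)
    (u : RMQubits m → ZMod 2) (h : ψ u ≠ 0) (z : RMQubits m → ZMod 2)
    (hz : z ∈ RMstar (m - 2) m) : ∑ p, z p * u p = 0 := by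
  have hv : (fun p => (z p, 0) : QV (RMQubits m)) ∈ cssL m :=
    ⟨hz, (RMstar 1 m).zero_mem⟩
  have h1 := congrFun (hψ _ hv) u
  rw [hσ _ hv, Wop_mulVec, prod_neg_one_pow_val] at h1
  have h0 : u + xPart (fun p => (z p, 0) : QV (RMQubits m)) = u := add_zero u
  rw [h0] at h1
  have h2 := mul_right_cancel₀ h (h1.trans (one_mul _).symm)
  revert h2
  simp only
  generalize ∑ p, z p * u p = b
  rcases zmod_two_eq_zero_or_one b with rfl | rfl
  · simp
  · norm_num [ZMod.val_one]

/-- **The transversal rotation of the Reed–Muller code.** For `m ≥ 2` let `L ⊆ V^P` be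
the CSS isotropic subspace built from `R_*(m−2, m)` and `R_*(1, m)`, with the standard
section `σ`. Then the simultaneous rotation about each `z`-axis by the angle
`2π/2^{m−1}` belongs to `A(L, σ)` and has order `2^{m−1}`. -/
theorem reed_muller_transversal (m : ℕ) (hm : 2 ≤ m)
    (σ : PauliSection (cssL m)) (hσ : StandardOn (cssL m) σ) :
    (fun _ : RMQubits m => rotZ (2 * π / 2 ^ (m - 1))) ∈ autSet (cssL m) σ ∧
    orderOf (fun _ : RMQubits m => rotZ (2 * π / 2 ^ (m - 1))) = 2 ^ (m - 1) := by
  obtain ⟨N, hN⟩ : ∃ N, N = 2 ^ (m - 1) := ⟨_, rfl⟩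
  have hN0 : 0 < N := hN ▸ by positivity
  have hNR : (2 : ℝ) ^ (m - 1) = N := by rw [hN]; push_cast; rfl
  rw [hNR, ← hN]
  constructor
  · refine ⟨fun _ => phaseMat (2 * π / N), fun _ => phaseMat_mem_unitaryGroup _,
      fun _ => adjRot_phaseMat _, fun ψ hψ v hv => ?_⟩
    have hζ : Complex.exp ((2 * π / N : ℝ) * Complex.I) ^ 2 ^ (m - 1) = 1 := by
      rw [← hN, ← Complex.exp_nat_mul]
      have hNC : (N : ℂ) ≠ 0 := by exact_mod_cast hN0.ne'
      rw [← Complex.exp_two_pi_mul_I]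
      congr 1
      push_cast
      field_simp
    funext (u : RMQubits m → ZMod 2)
    have hfix := congrFun (hψ v hv) u
    rw [hσ v hv, Wop_mulVec] at hfix ⊢
    rw [locOp_phaseMat_mulVec, locOp_phaseMat_mulVec, mul_left_comm, hfix]
    by_cases h0 : ψ u = 0
    · rw [h0, mul_zero, mul_zero]
    · rw [pow_weight_add_eq (by omega) hζ u _
        (sum_mul_eq_zero_of_apply_ne_zero hσ hψ u h0) hv.2]
  · have : Nonempty (RMQubits m) :=
      ⟨⟨fun _ => 1, fun h => one_ne_zero (congrFun h ⟨0, by omega⟩)⟩⟩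
    exact (orderOf_injective (Pi.constMonoidHom (RMQubits m) Rot)
      Function.const_injective (rotZ (2 * π / N))).trans (orderOf_rotZ hN0)

end Stab
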